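/- Let p ≥ 3 be prime, m = 6p² − 6p + 1, and A'' ∈ C^{m×p} with entries A''_{j,k} = exp(i 2π j g(k)/m), where g(k) = 2pk + (k²)_p. Then for all x ∈ C^p, (m/√2) ||x||_2 ≤ ||A'' x||_1 ≤ m ||x||_2; in particular A'' embeds l_2^p(C) into l_1^m(C) with distortion at most √2. -/

import Mathlib

open Finset in
lemma aux_orth (m : ℕ) (hm : m ≠ 0) (ζ : ℂ) (hζ : IsPrimitiveRoot ζ m) (a b : ℕ) (ha : a < m)
    (hb : b < m) :
    ∑ j : Fin m, ζ ^ ((j : ℕ) * a) * (starRingEnd ℂ) (ζ ^ ((j : ℕ) * b)) =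
      if a = b then (m : ℂ) else 0 := by
  have hn : ‖ζ‖ = 1 := hζ.norm'_eq_one hm
  have hz : ζ ≠ 0 := hζ.ne_zero hm
  have hc : (starRingEnd ℂ) ζ = ζ⁻¹ := by
    rw [Complex.inv_eq_conj hn]
  have h1 : ∀ j : Fin m, ζ ^ ((j : ℕ) * a) * (starRingEnd ℂ) (ζ ^ ((j : ℕ) * b)) =
      (ζ ^ a * (ζ ^ b)⁻¹) ^ (j : ℕ) := by
    intro j
    rw [map_pow, hc, mul_pow, inv_pow, inv_pow, ← pow_mul, ← pow_mul, mul_comm a, mul_comm b]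
  rw [Finset.sum_congr rfl (fun j _ => h1 j),
    Fin.sum_univ_eq_sum_range (fun j => (ζ ^ a * (ζ ^ b)⁻¹) ^ j) m]
  split_ifs with hab
  · subst hab
    rw [mul_inv_cancel₀ (pow_ne_zero _ hz)]
    simp
  · have hw : ζ ^ a * (ζ ^ b)⁻¹ ≠ 1 := by
      intro h
      apply hab
      apply hζ.pow_inj ha hb
      rwa [mul_inv_eq_one₀ (pow_ne_zero _ hz)] at h
    rw [geom_sum_eq hw, mul_pow, inv_pow, ← pow_mul, ← pow_mul, mul_comm a, mul_comm b,
      pow_mul, pow_mul, hζ.pow_eq_one]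
    simp

lemma aux_sum (m : ℕ) (hm : m ≠ 0) (ζ : ℂ) (hζ : IsPrimitiveRoot ζ m) {ι : Type*} [Fintype ι]
    (f : ι → ℕ) (hf : ∀ i, f i < m) (y : ι → ℂ) :
    ((∑ j : Fin m, ‖∑ i, ζ ^ ((j : ℕ) * f i) * y i‖ ^ 2 : ℝ) : ℂ) =
      m * ∑ i, ∑ i', if f i = f i' then y i * (starRingEnd ℂ) (y i') else 0 := by
  have h1 : ∀ j : Fin m, ((‖∑ i, ζ ^ ((j : ℕ) * f i) * y i‖ ^ 2 : ℝ) : ℂ) =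
      ∑ i, ∑ i', (y i * (starRingEnd ℂ) (y i')) *
        (ζ ^ ((j : ℕ) * f i) * (starRingEnd ℂ) (ζ ^ ((j : ℕ) * f i'))) := by
    intro j
    push_cast
    rw [← Complex.mul_conj', map_sum, Finset.sum_mul_sum]
    refine Finset.sum_congr rfl fun i _ => Finset.sum_congr rfl fun i' _ => ?_
    rw [map_mul]; ring
  rw [Complex.ofReal_sum, Finset.sum_congr rfl (fun j _ => h1 j), Finset.sum_comm, Finset.mul_sum]
  refine Finset.sum_congr rfl fun i _ => ?_
  rw [Finset.sum_comm, Finset.mul_sum]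
  refine Finset.sum_congr rfl fun i' _ => ?_
  rw [← Finset.mul_sum, aux_orth m hm ζ hζ _ _ (hf i) (hf i')]
  split_ifs <;> ring

lemma aux_sidon (p : ℕ) (hp : p.Prime) (hp3 : 3 ≤ p) (a b c d : Fin p)
    (h : (2 * p * (a : ℕ) + (a : ℕ) ^ 2 % p) + (2 * p * (b : ℕ) + (b : ℕ) ^ 2 % p) =
      (2 * p * (c : ℕ) + (c : ℕ) ^ 2 % p) + (2 * p * (d : ℕ) + (d : ℕ) ^ 2 % p)) :
    (c = a ∧ d = b) ∨ (c = b ∧ d = a) := by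
  have hp0 : 0 < p := hp.pos
  have := Fact.mk hp
  have ha := Nat.mod_lt ((a : ℕ) ^ 2) hp0
  have hb := Nat.mod_lt ((b : ℕ) ^ 2) hp0
  have hc := Nat.mod_lt ((c : ℕ) ^ 2) hp0
  have hd := Nat.mod_lt ((d : ℕ) ^ 2) hp0
  set r := (a : ℕ) ^ 2 % p + (b : ℕ) ^ 2 % p with hr
  set s := (c : ℕ) ^ 2 % p + (d : ℕ) ^ 2 % p with hs
  have h' : 2 * p * ((a : ℕ) + b) + r = 2 * p * ((c : ℕ) + d) + s := by
    rw [hr, hs]; linarith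
  have hsum : (a : ℕ) + b = c + d := by
    have e : (2 * p * ((a : ℕ) + b) + r) / (2 * p) = (2 * p * ((c : ℕ) + d) + s) / (2 * p) := by
      rw [h']
    rwa [Nat.mul_add_div (by omega), Nat.mul_add_div (by omega), Nat.div_eq_of_lt (by omega),
      Nat.div_eq_of_lt (by omega)] at e
  have hrs : r = s := by rw [hsum] at h'; omega
  have e1 : ((a : ℕ) : ZMod p) + (b : ℕ) = (c : ℕ) + (d : ℕ) := by exact_mod_cast congrArg (Nat.cast : ℕ → ZMod p) hsum
  have e2 : ((a : ℕ) : ZMod p) ^ 2 + ((b : ℕ) : ZMod p) ^ 2 = ((c : ℕ) : ZMod p) ^ 2 + ((d : ℕ) : ZMod p) ^ 2 := by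
    have := congrArg (Nat.cast : ℕ → ZMod p) hrs
    rw [hr, hs] at this
    simpa using this
  have h2 : (2 : ZMod p) ≠ 0 := by
    intro h0
    have : ((2 : ℕ) : ZMod p) = 0 := by exact_mod_cast h0
    rw [ZMod.natCast_eq_zero_iff] at this
    have := Nat.le_of_dvd (by norm_num) this
    omega
  have e3 : (2 : ZMod p) * ((((c : ℕ) : ZMod p) - (a : ℕ)) * (((c : ℕ) : ZMod p) - (b : ℕ))) = 0 := by
    have hd' : ((d : ℕ) : ZMod p) = (a : ℕ) + (b : ℕ) - (c : ℕ) := by rw [e1]; ring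
    rw [hd'] at e2
    linear_combination -e2
  have inj : ∀ u v : Fin p, ((u : ℕ) : ZMod p) - (v : ℕ) = 0 → (u : ℕ) = v := by
    intro u v huv
    rw [sub_eq_zero, ZMod.natCast_eq_natCast_iff] at huv
    exact Nat.ModEq.eq_of_lt_of_lt huv u.2 v.2
  rcases mul_eq_zero.mp e3 with h0 | h0
  · exact absurd h0 h2
  rcases mul_eq_zero.mp h0 with h0 | h0
  · have := inj _ _ h0
    left; constructor <;> apply Fin.ext <;> omega
  · have := inj _ _ h0
    right; constructor <;> apply Fin.ext <;> omega

lemma aux_final {m : ℕ} (hm : 0 < m) (y : Fin m → ℝ) (hy : ∀ j, 0 ≤ y j) (S : ℝ) (hS : 0 ≤ S)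
    (h2 : ∑ j, y j ^ 2 = m * S) (h4 : ∑ j, y j ^ 4 ≤ 2 * m * S ^ 2) :
    ((m : ℝ) / Real.sqrt 2) * Real.sqrt S ≤ ∑ j, y j ∧ ∑ j, y j ≤ (m : ℝ) * Real.sqrt S := by
  have hT : 0 ≤ ∑ j, y j := Finset.sum_nonneg fun j _ => hy j
  have hm' : (0 : ℝ) < m := by exact_mod_cast hm
  set T := ∑ j, y j with hTd
  constructor
  · have key : (m : ℝ) ^ 2 * S ≤ 2 * T ^ 2 := by
      rcases hS.eq_or_lt with h0 | hpos
      · rw [← h0]; nlinarith [sq_nonneg T]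
      set U := ∑ j, y j ^ 3 with hU
      have hU0 : 0 ≤ U := Finset.sum_nonneg fun j _ => pow_nonneg (hy j) 3
      have c1 : (m * S) ^ 2 ≤ T * U := by
        rw [← h2]
        apply Finset.sum_sq_le_sum_mul_sum_of_sq_eq_mul
        · intro j _; exact hy j
        · intro j _; exact pow_nonneg (hy j) 3
        · intro j _; ring
      have c2 : U ^ 2 ≤ (m * S) * (2 * m * S ^ 2) := by
        refine le_trans ?_ (mul_le_mul_of_nonneg_left h4 (by positivity))
        rw [← h2]
        apply Finset.sum_sq_le_sum_mul_sum_of_sq_eq_mul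
        · intro j _; positivity
        · intro j _; positivity
        · intro j _; ring
      have c3 : (m * S) ^ 4 ≤ T ^ 2 * ((m * S) * (2 * m * S ^ 2)) := by
        calc (m * S) ^ 4 = ((m * S) ^ 2) ^ 2 := by ring
          _ ≤ (T * U) ^ 2 := by gcongr
          _ = T ^ 2 * U ^ 2 := by ring
          _ ≤ _ := by gcongr
      have hq : 0 < (m : ℝ) ^ 2 * S ^ 3 := by positivity
      refine le_of_mul_le_mul_left ?_ hq
      calc _ = (m * S) ^ 4 := by ring
        _ ≤ _ := c3
        _ = _ := by ring
    refine le_of_abs_le (abs_le_of_sq_le_sq ?_ hT)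
    rw [mul_pow, div_pow, Real.sq_sqrt hS, Real.sq_sqrt (by norm_num)]
    linarith
  · refine le_of_abs_le (abs_le_of_sq_le_sq ?_ (by positivity))
    rw [mul_pow, Real.sq_sqrt hS]
    have := sq_sum_le_card_mul_sum_sq (s := Finset.univ) (f := y)
    rw [h2] at this
    simp at this
    nlinarith

/-- The Golomb-ruler matrix `A''` embeds `ℓ₂^p(ℂ)` into `ℓ₁^m(ℂ)` with distortion
at most `√2`: `(m/√2) ‖x‖₂ ≤ ‖A''x‖₁ ≤ m ‖x‖₂`. -/
theorem stmt7 (p : ℕ) (hp : p.Prime) (hp3 : 3 ≤ p) (m : ℕ) (hm : m = 6 * p ^ 2 - 6 * p + 1)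
    (A : Matrix (Fin m) (Fin p) ℂ)
    (hA : ∀ (j : Fin m) (k : Fin p),
      A j k = Complex.exp (2 * (Real.pi : ℂ) * Complex.I *
        ((j : ℕ) * (2 * p * (k : ℕ) + (k : ℕ) ^ 2 % p) : ℕ) / (m : ℕ)))
    (x : Fin p → ℂ) :
    ((m : ℝ) / Real.sqrt 2) * Real.sqrt (∑ k, ‖x k‖ ^ 2) ≤ ∑ j, ‖A.mulVec x j‖ ∧
    ∑ j, ‖A.mulVec x j‖ ≤ (m : ℝ) * Real.sqrt (∑ k, ‖x k‖ ^ 2) := by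
  have hm0 : m ≠ 0 := by omega
  have hζ := Complex.isPrimitiveRoot_exp m hm0
  set ζ := Complex.exp (2 * Real.pi * Complex.I / m) with hζd
  obtain ⟨g, hg⟩ : ∃ g : Fin p → ℕ, ∀ k, g k = 2 * p * (k : ℕ) + (k : ℕ) ^ 2 % p :=
    ⟨_, fun _ => rfl⟩
  have hAz : ∀ j, A.mulVec x j = ∑ k, ζ ^ ((j : ℕ) * g k) * x k := by
    intro j
    rw [Matrix.mulVec, dotProduct]
    refine Finset.sum_congr rfl fun k _ => ?_
    rw [hA, ← hg, hζd, ← Complex.exp_nat_mul]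
    congr 2
    ring
  have hglt : ∀ a b, g a + g b < m := by
    intro a b
    have h1 : ∀ a : Fin p, g a + p + 1 ≤ 2 * p ^ 2 := by
      intro a
      rw [hg]
      have := Nat.mod_lt ((a : ℕ) ^ 2) hp.pos
      have h3 : 2 * p * ((a : ℕ) + 1) ≤ 2 * p * p := Nat.mul_le_mul_left _ a.2
      nlinarith
    have := h1 a
    have := h1 b
    have : 3 * p ≤ p ^ 2 := by nlinarith
    omega
  have hsid : ∀ a b c d, g a + g b = g c + g d → (c = a ∧ d = b) ∨ (c = b ∧ d = a) := by
    intro a b c d h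
    rw [hg, hg, hg, hg] at h
    exact aux_sidon p hp hp3 a b c d h
  have hinj : ∀ a b, g a = g b ↔ a = b := by
    intro a b
    refine ⟨fun h => ?_, fun h => by rw [h]⟩
    rcases hsid a a b b (by omega) with h | h <;> exact h.1.symm
  have hmpos : 0 < m := Nat.pos_of_ne_zero hm0
  refine aux_final hmpos (fun j => ‖A.mulVec x j‖) (fun j => norm_nonneg _) (∑ k, ‖x k‖ ^ 2)
    (by positivity) ?_ ?_
  · have h := aux_sum m hm0 ζ hζ g (fun k => lt_of_le_of_lt (Nat.le_add_right _ _) (hglt k k)) x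
    simp only [hAz]
    apply Complex.ofReal_injective
    rw [h]
    push_cast
    congr 1
    refine Finset.sum_congr rfl fun k _ => ?_
    simp only [hinj, Finset.sum_ite_eq, Finset.mem_univ, if_true]
    exact Complex.mul_conj' _
  · have h := aux_sum m hm0 ζ hζ (fun q : Fin p × Fin p => g q.1 + g q.2) (fun q => hglt _ _)
      (fun q => x q.1 * x q.2)
    have h1 : ∀ j : Fin m, ‖∑ q : Fin p × Fin p, ζ ^ ((j : ℕ) * (g q.1 + g q.2)) *
        (x q.1 * x q.2)‖ ^ 2 = ‖A.mulVec x j‖ ^ 4 := by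
      intro j
      have : ∑ q : Fin p × Fin p, ζ ^ ((j : ℕ) * (g q.1 + g q.2)) * (x q.1 * x q.2) =
          A.mulVec x j ^ 2 := by
        rw [hAz, sq, Finset.sum_mul_sum, Fintype.sum_prod_type]
        refine Finset.sum_congr rfl fun a _ => Finset.sum_congr rfl fun b _ => ?_
        rw [mul_add, pow_add]; ring
      rw [this, norm_pow]; ring
    simp only [h1] at h
    have hn := congrArg norm h
    rw [Complex.norm_real, Real.norm_of_nonneg (by positivity), norm_mul, Complex.norm_natCast] at hn
    change ∑ j, ‖A.mulVec x j‖ ^ 4 ≤ _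
    rw [hn, mul_comm 2 (m : ℝ), mul_assoc]
    refine mul_le_mul_of_nonneg_left ?_ (by positivity)
    have hS : (∑ k, ‖x k‖ ^ 2) ^ 2 = ∑ q : Fin p × Fin p, (‖x q.1‖ * ‖x q.2‖) ^ 2 := by
      rw [sq, Finset.sum_mul_sum, Fintype.sum_prod_type]
      simp only [mul_pow]
    rw [hS, Finset.mul_sum]
    refine (norm_sum_le _ _).trans (Finset.sum_le_sum fun q _ => (norm_sum_le _ _).trans ?_)
    have h3 : ∀ q' : Fin p × Fin p,
        ‖(if g q.1 + g q.2 = g q'.1 + g q'.2 then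
          x q.1 * x q.2 * (starRingEnd ℂ) (x q'.1 * x q'.2) else 0)‖ ≤
        (if q' = q then (‖x q.1‖ * ‖x q.2‖) ^ 2 else 0) +
        (if q' = q.swap then (‖x q.1‖ * ‖x q.2‖) ^ 2 else 0) := by
      rintro ⟨c, d⟩
      obtain ⟨a, b⟩ := q
      have hi1 : 0 ≤ (if (c, d) = (a, b) then (‖x a‖ * ‖x b‖) ^ 2 else 0) := by
        split_ifs <;> positivity
      have hi2 : 0 ≤ (if (c, d) = (b, a) then (‖x a‖ * ‖x b‖) ^ 2 else 0) := by
        split_ifs <;> positivity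
      simp only [Prod.swap_prod_mk]
      by_cases hq : g a + g b = g c + g d
      · rw [if_pos hq, norm_mul, RCLike.norm_conj, norm_mul, norm_mul]
        rcases hsid _ _ _ _ hq with ⟨e1, e2⟩ | ⟨e1, e2⟩
        · have hi3 : (if (c, d) = (a, b) then (‖x a‖ * ‖x b‖) ^ 2 else 0) =
              (‖x a‖ * ‖x b‖) ^ 2 := if_pos (by rw [e1, e2])
          rw [hi3, e1, e2]
          rw [e1, e2] at hi2
          linarith
        · have hi3 : (if (c, d) = (b, a) then (‖x a‖ * ‖x b‖) ^ 2 else 0) =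
              (‖x a‖ * ‖x b‖) ^ 2 := if_pos (by rw [e1, e2])
          rw [hi3, e1, e2]
          rw [e1, e2] at hi1
          linarith
      · rw [if_neg hq, norm_zero]
        exact add_nonneg hi1 hi2
    refine (Finset.sum_le_sum fun q' _ => h3 q').trans ?_
    rw [Finset.sum_add_distrib]
    simp only [Finset.sum_ite_eq', Finset.mem_univ, if_true]
    linarith
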